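/- arXiv:0805.4300 — 8 statements merged into one kernel-verified Lean document; each statement's English description precedes it below -/
import Mathlib

section
/- Let n, k be integers with 1 ≤ k < l and k ≤ n, let δ, γ ≥ 1 be reals, let H be a δ-balanced (n,k,l)-splitter consisting of N functions from [n] to [l], and let G be a γ-balanced (l,k)-family of perfect hash functions consisting of M functions from [l] to [k]. Then the multiset of all N·M compositions {g ∘ h : h ∈ H, g ∈ G} is a δγ-balanced (n,k)-family of perfect hash functions of size N·M. -/
open Finset

attribute [local instance] Classical.propDecidable

/-- The number of functions in the family `F` (indexed by `ι`) that are injective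
on the set `S`. -/
noncomputable def injCount {α β ι : Type*} [Fintype ι] (F : ι → α → β) (S : Finset α) : ℕ :=
  (Finset.univ.filter fun i => Set.InjOn (F i) ↑S).card

/-- `injCount` does not depend on how injectivity on `S` is decided. -/
theorem injCount_eq_card {α β ι : Type*} [Fintype ι] (F : ι → α → β) (S : Finset α)
    [DecidablePred fun i => Set.InjOn (F i) ↑S] :
    injCount F S = #{i | Set.InjOn (F i) ↑S} := by
  unfold injCount
  congr!

/-- A composition is injective on `S` iff the inner function is injective on `S` and the outer one
is injective on its image, so the count for compositions fibers over the inner family. -/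
theorem injCount_comp {α β γ ι κ : Type*} [DecidableEq β] [Fintype ι] [Fintype κ]
    (F : ι → α → β) (G : κ → β → γ) (S : Finset α) [DecidablePred fun i => Set.InjOn (F i) ↑S] :
    injCount (fun p : ι × κ => G p.2 ∘ F p.1) S =
      ∑ i with Set.InjOn (F i) ↑S, injCount G (S.image (F i)) := by
  have h (i : ι) (j : κ) : Set.InjOn (G j ∘ F i) ↑S ↔
      Set.InjOn (F i) ↑S ∧ Set.InjOn (G j) ↑(S.image (F i)) := by
    rw [Finset.coe_image]
    refine ⟨fun hc => ⟨hc.of_comp, hc.image_of_comp⟩, fun hFG => ?_⟩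
    exact hFG.2.comp hFG.1 (Set.mapsTo_image _ _)
  simp only [injCount, Finset.card_filter, Finset.sum_filter, Fintype.sum_prod_type, h]
  refine Finset.sum_congr rfl fun i _ => ?_
  by_cases hi : Set.InjOn (F i) ↑S <;> simp [hi]

/-- composing a `δ`-balanced `(n,k,l)`-splitter (here `k < l`, so its splitting
property is being injective on each `k`-set) with a `γ`-balanced `(l,k)`-family of perfect hash
functions yields a `δγ`-balanced `(n,k)`-family of perfect hash functions of size `N·M`. -/
theorem stmt0 (n k l N M : ℕ) (hk : 1 ≤ k) (hkl : k < l) (hkn : k ≤ n)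
    (δ γ : ℝ) (hδ : 1 ≤ δ) (hγ : 1 ≤ γ)
    (H : Fin N → Fin n → Fin l) (G : Fin M → Fin l → Fin k)
    (hH : ∃ T : ℝ, 0 < T ∧ ∀ S : Finset (Fin n), S.card = k →
      T / δ ≤ (injCount H S : ℝ) ∧ (injCount H S : ℝ) ≤ δ * T)
    (hG : ∃ T : ℝ, 0 < T ∧ ∀ S : Finset (Fin l), S.card = k →
      T / γ ≤ (injCount G S : ℝ) ∧ (injCount G S : ℝ) ≤ γ * T) :
    Fintype.card (Fin N × Fin M) = N * M ∧
    ∃ T : ℝ, 0 < T ∧ ∀ S : Finset (Fin n), S.card = k →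
      T / (δ * γ) ≤ (injCount (fun p : Fin N × Fin M => G p.2 ∘ H p.1) S : ℝ) ∧
      (injCount (fun p : Fin N × Fin M => G p.2 ∘ H p.1) S : ℝ) ≤ (δ * γ) * T := by
  refine ⟨by simp, ?_⟩
  obtain ⟨T, hT, hH⟩ := hH
  obtain ⟨U, hU, hG⟩ := hG
  refine ⟨T * U, mul_pos hT hU, fun S hS => ?_⟩
  have hcard {i : Fin N} (hi : Set.InjOn (H i) ↑S) :
      (S.image (H i)).card = k := by
    rw [Finset.card_image_of_injOn hi, hS]
  obtain ⟨hlo, hhi⟩ := hH S hS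
  have hδ0 : 0 < δ := by linarith
  have hγ0 : 0 < γ := by linarith
  rw [injCount_comp, Nat.cast_sum]
  constructor
  · calc T * U / (δ * γ) = T / δ * (U / γ) := by field_simp
      _ ≤ injCount H S * (U / γ) := by gcongr
      _ ≤ _ := by
        rw [injCount_eq_card, ← nsmul_eq_mul]
        refine Finset.card_nsmul_le_sum _ _ _ fun i hi => ?_
        exact (hG _ (hcard (by simpa using hi))).1
  · calc _ ≤ injCount H S * (γ * U) := by
          rw [injCount_eq_card, ← nsmul_eq_mul]
          refine Finset.sum_le_card_nsmul _ _ _ fun i hi => ?_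
          exact (hG _ (hcard (by simpa using hi))).2
      _ ≤ δ * T * (γ * U) := by gcongr
      _ = δ * γ * (T * U) := by ring
end

section
/- Let n, k, l be integers with 1 ≤ l < k ≤ n, let δ ≥ 1 and γ_1,…,γ_l ≥ 1 be reals. Set k_j = ⌈k/l⌉ for 1 ≤ j ≤ (k mod l) and k_j = ⌊k/l⌋ for (k mod l) < j ≤ l, and let I_1,…,I_l be the partition of [k] into consecutive intervals with |I_j| = k_j. Let H be a δ-balanced (n,k,l)-splitter of size N, and for each j let G_j be a γ_j-balanced (n,k_j)-family of perfect hash functions of size M_j, regarded (via the order-preserving bijection [k_j] ↔ I_j) as functions from [n] to I_j ⊆ [k]. Then the multiset of all functions x ↦ g_{h(x)}(x), over all choices of h ∈ H and g_j ∈ G_j for j = 1,…,l, is a (δ·∏_{j=1}^l γ_j)-balanced (n,k)-family of perfect hash functions of size N·∏_{j=1}^l M_j. -/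
open Finset

attribute [local instance] Classical.propDecidable

/-- The size of the `j`-th part (1-indexed part `j+1`): the first `k mod l` parts have size
`⌈k/l⌉` and the remaining ones have size `⌊k/l⌋`. -/
def partSize (k l : ℕ) (j : Fin l) : ℕ :=
  if (j : ℕ) < k % l then (k + l - 1) / l else k / l

/-- The starting offset of the `j`-th consecutive interval `I_j` inside `[k]`. -/
def partOffset (k l : ℕ) (j : Fin l) : ℕ :=
  ∑ j' ∈ Finset.univ.filter (fun j' : Fin l => j' < j), partSize k l j'

theorem partSize_eq {k l : ℕ} (hl : 1 ≤ l) (j : Fin l) :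
    partSize k l j = k / l + if (j : ℕ) < k % l then 1 else 0 := by
  unfold partSize
  split_ifs with h
  · have hk := Nat.div_add_mod k l
    have hm := Nat.mod_lt k hl
    have hkl : k + l - 1 = (k % l - 1) + l * (k / l + 1) := by
      rw [mul_add, mul_one]; omega
    rw [hkl, Nat.add_mul_div_left _ _ hl, Nat.div_eq_of_lt (by omega), zero_add]
  · rfl

theorem sum_partSize {k l : ℕ} (hl : 1 ≤ l) : ∑ j : Fin l, partSize k l j = k := by
  have hm := Nat.mod_lt k hl
  simp only [partSize_eq hl, sum_add_distrib, sum_const, card_univ, Fintype.card_fin, smul_eq_mul]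
  rw [Fin.sum_univ_eq_sum_range (fun j => if j < k % l then 1 else 0) l, ← card_filter]
  have hr : (range l).filter (fun j => j < k % l) = range (k % l) := by
    ext j; simp only [mem_filter, mem_range]; omega
  rw [hr, card_range, Nat.div_add_mod]

theorem partOffset_add_partSize_le {k l : ℕ} {i j : Fin l} (hij : i < j) :
    partOffset k l i + partSize k l i ≤ partOffset k l j := by
  unfold partOffset
  rw [add_comm, ← sum_insert (by simp)]
  refine sum_le_sum_of_subset fun a ha => ?_
  simp only [mem_insert, mem_filter, mem_univ, true_and] at ha ⊢
  rcases ha with rfl | ha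
  · exact hij
  · exact ha.trans hij

/-- Consecutive intervals are pairwise disjoint. -/
theorem eq_of_mem_part {k l : ℕ} {i j : Fin l} {a : ℕ}
    (hi : partOffset k l i ≤ a ∧ a < partOffset k l i + partSize k l i)
    (hj : partOffset k l j ≤ a ∧ a < partOffset k l j + partSize k l j) : i = j := by
  rcases lt_trichotomy i j with h | h | h
  · have := partOffset_add_partSize_le (k := k) h
    omega
  · exact h
  · have := partOffset_add_partSize_le (k := k) h
    omega

/-- Gluing functions with disjoint ranges along `h` is injective on `S` exactly when each of them
is injective on its part of `S`. -/
theorem injOn_glue_iff {α : Type*} {k l : ℕ} (h : α → Fin l) (g : Fin l → α → Fin k)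
    (hg : ∀ j x, partOffset k l j ≤ (g j x : ℕ) ∧
      (g j x : ℕ) < partOffset k l j + partSize k l j) (S : Finset α) :
    Set.InjOn (fun x => g (h x) x) ↑S ↔
      ∀ j, Set.InjOn (g j) ↑(S.filter fun x => h x = j) := by
  constructor
  · intro hinj j x hx y hy hxy
    simp only [coe_filter, Set.mem_ofPred_eq] at hx hy
    refine hinj hx.1 hy.1 ?_
    simpa [hx.2, hy.2] using hxy
  · intro hinj x hx y hy hxy
    have hxy' : g (h x) x = g (h y) y := hxy
    have hh : h x = h y := eq_of_mem_part (hg (h x) x) (by rw [hxy']; exact hg (h y) y)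
    refine hinj (h y) (by simpa [hh] using hx) (by simpa using hy) ?_
    rw [← hxy', hh]

theorem card_le_partSize_of_injOn {α : Type*} {k l : ℕ} {j : Fin l} {g : α → Fin k}
    (hg : ∀ x, partOffset k l j ≤ (g x : ℕ) ∧ (g x : ℕ) < partOffset k l j + partSize k l j)
    {S : Finset α} (hS : Set.InjOn g ↑S) : S.card ≤ partSize k l j := by
  have hc := card_le_card_of_injOn (s := S)
    (t := Finset.Ico (partOffset k l j) (partOffset k l j + partSize k l j))
    (fun x => (g x : ℕ)) (fun x _ => by simpa using hg x)
    (fun x hx y hy hxy => hS hx hy (Fin.ext hxy))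
  simpa using hc

theorem card_filter_eq_partSize {α : Type*} {k l : ℕ} (hl : 1 ≤ l) (h : α → Fin l)
    {S : Finset α} (hS : S.card = k)
    (hle : ∀ j, (S.filter fun x => h x = j).card ≤ partSize k l j) (j : Fin l) :
    (S.filter fun x => h x = j).card = partSize k l j := by
  have hsum : ∑ j, (S.filter fun x => h x = j).card = ∑ j, partSize k l j := by
    rw [sum_partSize hl, ← hS]
    exact (card_eq_sum_card_fiberwise fun x _ => mem_univ (h x)).symm
  exact (sum_eq_sum_iff_of_le fun j _ => hle j).1 hsum j (mem_univ j)

/-- The glued functions that are injective on `S` come exactly from the `h` splitting `S` and the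
`g j` that are injective on the parts of `S`. -/
theorem injCount_glue {α ι : Type*} [Fintype ι] {k l : ℕ} (hl : 1 ≤ l) {M : Fin l → ℕ}
    (H : ι → α → Fin l) (G : (j : Fin l) → Fin (M j) → α → Fin k)
    (hG : ∀ (j : Fin l) (i : Fin (M j)) (x : α),
      partOffset k l j ≤ (G j i x : ℕ) ∧ (G j i x : ℕ) < partOffset k l j + partSize k l j)
    {S : Finset α} (hS : S.card = k) :
    injCount (fun p : ι × ((j : Fin l) → Fin (M j)) =>
        fun x : α => G (H p.1 x) (p.2 (H p.1 x)) x) S =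
      ∑ i ∈ Finset.univ.filter (fun i : ι => ∀ j : Fin l,
          (S.filter fun x => H i x = j).card = partSize k l j),
        ∏ j, injCount (G j) (S.filter fun x => H i x = j) := by
  unfold injCount
  rw [card_filter, Fintype.sum_prod_type, sum_filter]
  refine sum_congr rfl fun i _ => ?_
  have hiff (g : (j : Fin l) → Fin (M j)) :
      Set.InjOn (fun x => G (H i x) (g (H i x)) x) ↑S ↔
        ∀ j, Set.InjOn (G j (g j)) ↑(S.filter fun x => H i x = j) :=
    injOn_glue_iff (H i) (fun j => G j (g j)) (fun j => hG j (g j)) S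
  simp only [hiff]
  split_ifs with hi
  · rw [← Fintype.card_piFinset, ← sum_filter, ← card_eq_sum_ones]
    congr 1
    ext g
    simp only [mem_filter, mem_univ, true_and, Fintype.mem_piFinset]
  · refine sum_eq_zero fun g _ => if_neg fun hinj => hi ?_
    exact card_filter_eq_partSize hl (H i) hS fun j =>
      card_le_partSize_of_injOn (hG j (g j)) (hinj j)

/-- composing a `δ`-balanced `(n,k,l)`-splitter `H` (here `k > l`) with
`γ_j`-balanced `(n,k_j)`-families `G_j` of perfect hash functions, where `G_j` is regarded as a
family of functions from `[n]` into the interval `I_j ⊆ [k]` of size `k_j`, yields a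
`(δ·∏ γ_j)`-balanced `(n,k)`-family of perfect hash functions of size `N·∏ M_j`. -/
theorem stmt1 (n k l N : ℕ) (hl : 1 ≤ l) (hlk : l < k) (hkn : k ≤ n)
    (δ : ℝ) (hδ : 1 ≤ δ) (γ : Fin l → ℝ) (hγ : ∀ j, 1 ≤ γ j)
    (M : Fin l → ℕ)
    (H : Fin N → Fin n → Fin l)
    (G : (j : Fin l) → Fin (M j) → Fin n → Fin k)
    -- each function of `G j` takes its values in the interval `I_j`
    (hrange : ∀ (j : Fin l) (i : Fin (M j)) (x : Fin n),
      partOffset k l j ≤ (G j i x : ℕ) ∧ (G j i x : ℕ) < partOffset k l j + partSize k l j)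
    -- `H` is a `δ`-balanced `(n,k,l)`-splitter (with `k > l`)
    (hH : ∃ T : ℝ, 0 < T ∧ ∀ S : Finset (Fin n), S.card = k →
      T / δ ≤ ((Finset.univ.filter (fun i : Fin N => ∀ j : Fin l,
          (S.filter fun x => H i x = j).card = partSize k l j)).card : ℝ) ∧
      ((Finset.univ.filter (fun i : Fin N => ∀ j : Fin l,
          (S.filter fun x => H i x = j).card = partSize k l j)).card : ℝ) ≤ δ * T)
    -- each `G j` is a `γ_j`-balanced `(n,k_j)`-family of perfect hash functions
    (hG : ∀ j : Fin l, ∃ T : ℝ, 0 < T ∧ ∀ S : Finset (Fin n), S.card = partSize k l j →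
      T / γ j ≤ (injCount (G j) S : ℝ) ∧ (injCount (G j) S : ℝ) ≤ γ j * T) :
    Fintype.card (Fin N × ((j : Fin l) → Fin (M j))) = N * ∏ j, M j ∧
    ∃ T : ℝ, 0 < T ∧ ∀ S : Finset (Fin n), S.card = k →
      T / (δ * ∏ j, γ j) ≤
        (injCount (fun p : Fin N × ((j : Fin l) → Fin (M j)) =>
          fun x : Fin n => G (H p.1 x) (p.2 (H p.1 x)) x) S : ℝ) ∧
      (injCount (fun p : Fin N × ((j : Fin l) → Fin (M j)) =>
          fun x : Fin n => G (H p.1 x) (p.2 (H p.1 x)) x) S : ℝ) ≤ (δ * ∏ j, γ j) * T := by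
  refine ⟨by simp, ?_⟩
  obtain ⟨T, hT, hsplit⟩ := hH
  choose U hU hinj using hG
  have hγ' (j : Fin l) : 0 < γ j := one_pos.trans_le (hγ j)
  refine ⟨T * ∏ j, U j, mul_pos hT (prod_pos fun j _ => hU j), fun S hS => ?_⟩
  obtain ⟨hlo, hhi⟩ := hsplit S hS
  rw [injCount_glue hl H G hrange hS]
  push_cast
  set A := Finset.univ.filter (fun i : Fin N => ∀ j : Fin l,
    (S.filter fun x => H i x = j).card = partSize k l j)
  have hpart (i : Fin N) (hi : i ∈ A) (j : Fin l) :=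
    hinj j (S.filter fun x => H i x = j) ((mem_filter.1 hi).2 j)
  constructor
  · calc (T * ∏ j, U j) / (δ * ∏ j, γ j)
        = T / δ * ∏ j, U j / γ j := by rw [prod_div_distrib]; ring
      _ ≤ A.card * ∏ j, U j / γ j :=
        mul_le_mul_of_nonneg_right hlo (prod_nonneg fun j _ => (div_pos (hU j) (hγ' j)).le)
      _ = ∑ _i ∈ A, ∏ j, U j / γ j := by rw [sum_const, nsmul_eq_mul]
      _ ≤ _ := sum_le_sum fun i hi => prod_le_prod
        (fun j _ => (div_pos (hU j) (hγ' j)).le) fun j _ => (hpart i hi j).1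
  · calc _ ≤ ∑ _i ∈ A, ∏ j, γ j * U j := sum_le_sum fun i hi => prod_le_prod
          (fun j _ => Nat.cast_nonneg _) fun j _ => (hpart i hi j).2
      _ = A.card * ∏ j, γ j * U j := by rw [sum_const, nsmul_eq_mul]
      _ ≤ δ * T * ∏ j, γ j * U j :=
        mul_le_mul_of_nonneg_right hhi (prod_nonneg fun j _ => (mul_pos (hγ' j) (hU j)).le)
      _ = (δ * ∏ j, γ j) * (T * ∏ j, U j) := by rw [prod_mul_distrib]; ring
end

section
/- For all integers 1 ≤ k ≤ n with n ≥ 2 and every real 1 < δ ≤ 2, setting p = k!/k^k and M = ⌈8(k·ln n + 1)/(p·(δ−1)²)⌉, there exists a δ-balanced (n,k)-family of perfect hash functions of size M; moreover one may take T = pM as the witnessing constant, i.e., there exist M functions from [n] to [k] such that every S ⊆ [n] with |S| = k has between pM/δ and δpM of them injective on S. -/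
open Finset

attribute [local instance] Classical.propDecidable

/-- `p = k!/k^k`, the probability that a uniformly random function from a fixed
`k`-element set to `[k]` is injective. -/
noncomputable def pHash (k : ℕ) : ℝ := (Nat.factorial k : ℝ) / (k : ℝ) ^ k

/-- `M = ⌈8(k·ln n + 1)/(p·(δ−1)²)⌉`. -/
noncomputable def MHash (n k : ℕ) (δ : ℝ) : ℕ :=
  ⌈(8 * ((k : ℝ) * Real.log n + 1)) / (pHash k * (δ - 1) ^ 2)⌉₊

theorem card_filter_injOn {n k : ℕ} (S : Finset (Fin n)) (hS : S.card = k) :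
    (Finset.univ.filter fun h : Fin n → Fin k => Set.InjOn h ↑S).card
      = k.factorial * k ^ (n - k) := by
  have e : {h : Fin n → Fin k // Set.InjOn h ↑S} ≃
      (S ↪ Fin k) × ({x // ¬ x ∈ S} → Fin k) :=
    ((Equiv.piEquivPiSubtypeProd (fun x => x ∈ S) (fun _ => Fin k)).subtypeEquiv
      (q := fun g => Function.Injective g.1)
      (fun h => Set.injOn_iff_injective)).trans
    ((Equiv.prodSubtypeFstEquivSubtypeProd (p := fun g : S → Fin k => Function.Injective g)).trans
      ((Equiv.subtypeInjectiveEquivEmbedding S (Fin k)).prodCongr (Equiv.refl _)))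
  rw [← Fintype.card_subtype, Fintype.card_congr e, Fintype.card_prod,
    Fintype.card_embedding_eq, Fintype.card_fun, Fintype.card_subtype_compl]
  simp [hS, Nat.descFactorial_self]

theorem pHash_pos {k : ℕ} (hk : 1 ≤ k) : 0 < pHash k := by
  unfold pHash
  positivity

theorem card_filter_injOn_eq_pHash_mul {n k : ℕ} (hk : 1 ≤ k) (hkn : k ≤ n)
    (S : Finset (Fin n)) (hS : S.card = k) :
    ((Finset.univ.filter fun h : Fin n → Fin k => Set.InjOn h ↑S).card : ℝ)
      = pHash k * (k : ℝ) ^ n := by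
  rw [card_filter_injOn S hS]
  obtain ⟨m, rfl⟩ := Nat.exists_eq_add_of_le hkn
  have : (k : ℝ) ≠ 0 := by positivity
  unfold pHash
  push_cast
  rw [Nat.add_sub_cancel_left, pow_add]
  field_simp

/-- The moment generating function of `injCount`, for a family of `M` functions chosen uniformly
at random, is at most that of a Poisson variable of mean `pHash k * M`. -/
theorem sum_exp_mul_injCount_le {n k : ℕ} (hk : 1 ≤ k) (hkn : k ≤ n) (M : ℕ)
    (S : Finset (Fin n)) (hS : S.card = k) (s : ℝ) :
    ∑ F : Fin M → Fin n → Fin k, Real.exp (s * injCount F S)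
      ≤ ((k : ℝ) ^ n) ^ M * Real.exp (pHash k * M * (Real.exp s - 1)) := by
  have hexp : ∀ F : Fin M → Fin n → Fin k, Real.exp (s * injCount F S)
      = ∏ i, (1 + if Set.InjOn (F i) ↑S then Real.exp s - 1 else 0) := by
    intro F
    have : ∀ i, (1 + if Set.InjOn (F i) ↑S then Real.exp s - 1 else 0)
        = if Set.InjOn (F i) ↑S then Real.exp s else 1 := by
      intro i; split_ifs <;> ring
    simp_rw [this]
    rw [Finset.prod_ite, Finset.prod_const, Finset.prod_const_one, mul_one, ← Real.exp_nat_mul,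
      mul_comm, injCount]
    congr!
  simp_rw [hexp]
  rw [← Fintype.sum_pow
    (fun h : Fin n → Fin k => 1 + if Set.InjOn h ↑S then Real.exp s - 1 else 0)]
  have hsum : ∑ h : Fin n → Fin k, ((1 : ℝ) + if Set.InjOn h ↑S then Real.exp s - 1 else 0)
      = (k : ℝ) ^ n * (pHash k * (Real.exp s - 1) + 1) := by
    rw [Finset.sum_add_distrib, ← Finset.sum_filter, Finset.sum_const, Finset.sum_const,
      nsmul_eq_mul, nsmul_eq_mul, card_filter_injOn_eq_pHash_mul hk hkn S hS]
    simp
    ring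
  have hnonneg : 0 ≤ ∑ h : Fin n → Fin k,
      ((1 : ℝ) + if Set.InjOn h ↑S then Real.exp s - 1 else 0) := by
    refine Finset.sum_nonneg fun h _ => ?_
    split_ifs
    · linarith [Real.exp_pos s]
    · norm_num
  calc _ ≤ ((k : ℝ) ^ n * Real.exp (pHash k * (Real.exp s - 1))) ^ M := by
        refine pow_le_pow_left₀ hnonneg ?_ M
        rw [hsum]
        gcongr
        exact Real.add_one_le_exp _
    _ = _ := by
        rw [mul_pow, ← Real.exp_nat_mul]
        congr 2
        ring

theorem Real.exp_neg_le_quadratic_of_nonneg {t : ℝ} (ht : 0 ≤ t) :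
    Real.exp (-t) ≤ 1 - t + t ^ 2 / 2 := by
  have h := Real.quadratic_le_exp_of_nonneg ht
  have hq : 0 < 1 - t + t ^ 2 / 2 := by nlinarith [sq_nonneg (t - 1)]
  rw [Real.exp_neg, inv_le_comm₀ (Real.exp_pos t) hq]
  refine le_trans ?_ h
  rw [inv_le_iff_one_le_mul₀ hq]
  nlinarith [sq_nonneg (t ^ 2)]

/-- Exponential Markov bound for both tails at once. -/
theorem one_le_exp_add_exp_of_not_between {x T δ t : ℝ} (ht : 0 ≤ t)
    (h : ¬(T / δ ≤ x ∧ x ≤ δ * T)) :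
    1 ≤ Real.exp (-(t * δ * T)) * Real.exp (t * x)
      + Real.exp (t * (T / δ)) * Real.exp (-t * x) := by
  rw [← Real.exp_add, ← Real.exp_add]
  rw [not_and_or, not_le, not_le] at h
  rcases h with h | h
  · have : 1 ≤ Real.exp (t * (T / δ) + -t * x) := Real.one_le_exp (by nlinarith)
    linarith [Real.exp_pos (-(t * δ * T) + t * x)]
  · have : 1 ≤ Real.exp (-(t * δ * T) + t * x) := Real.one_le_exp (by nlinarith)
    linarith [Real.exp_pos (t * (T / δ) + -t * x)]

/-- with `p = k!/k^k` and `M = ⌈8(k ln n + 1)/(p(δ−1)²)⌉` there exist `M`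
functions from `[n]` to `[k]` such that every `k`-set `S ⊆ [n]` has between `pM/δ` and `δpM`
of them injective on `S`; in particular this is a `δ`-balanced `(n,k)`-family of perfect hash
functions of size `M` with witnessing constant `T = pM`. -/
theorem stmt2 (n k : ℕ) (hk : 1 ≤ k) (hkn : k ≤ n) (hn : 2 ≤ n)
    (δ : ℝ) (hδ1 : 1 < δ) (hδ2 : δ ≤ 2) :
    ∃ F : Fin (MHash n k δ) → Fin n → Fin k,
      ∀ S : Finset (Fin n), S.card = k →
        pHash k * (MHash n k δ : ℝ) / δ ≤ (injCount F S : ℝ) ∧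
        (injCount F S : ℝ) ≤ δ * (pHash k * (MHash n k δ : ℝ)) := by
  set M := MHash n k δ with hM
  set T := pHash k * (M : ℝ) with hT
  set t := (δ - 1) / 2 with ht
  have hp := pHash_pos hk
  have hT0 : 0 ≤ T := by positivity
  have ht0 : 0 < t := by rw [ht]; linarith
  have hT8 : (k : ℝ) * Real.log n + 1 ≤ T * ((δ - 1) ^ 2 / 8) := by
    have hd : 0 < pHash k * (δ - 1) ^ 2 := mul_pos hp (by nlinarith)
    have := Nat.le_ceil ((8 * ((k : ℝ) * Real.log n + 1)) / (pHash k * (δ - 1) ^ 2))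
    change _ ≤ (M : ℝ) at this
    rw [div_le_iff₀ hd] at this
    rw [hT]
    linarith
  set B := Real.exp (-((k : ℝ) * Real.log n + 1)) with hB
  have hup : Real.exp (-(t * δ * T)) * Real.exp (T * (Real.exp t - 1)) ≤ B := by
    rw [← Real.exp_add, hB]
    refine Real.exp_le_exp.2 ?_
    have h1 := (abs_le.1 (Real.abs_exp_sub_one_sub_id_le
      (abs_le.2 ⟨by linarith, by rw [ht]; linarith⟩ : |t| ≤ 1))).2
    have h2 : Real.exp t - 1 - t * δ ≤ -((δ - 1) ^ 2 / 8) := by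
      rw [ht] at h1 ⊢; nlinarith
    nlinarith [mul_le_mul_of_nonneg_left h2 hT0]
  have hlow : Real.exp (t * (T / δ)) * Real.exp (T * (Real.exp (-t) - 1)) ≤ B := by
    rw [← Real.exp_add, hB]
    refine Real.exp_le_exp.2 ?_
    have h1 := Real.exp_neg_le_quadratic_of_nonneg ht0.le
    have h2 : 1 / δ ≤ 1 - t := by
      rw [div_le_iff₀ (by linarith), ht]; nlinarith
    have h3 : t * (1 / δ) + Real.exp (-t) - 1 ≤ -((δ - 1) ^ 2 / 8) := by
      have := mul_le_mul_of_nonneg_left h2 ht0.le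
      have h4 : (δ - 1) ^ 2 / 8 = t ^ 2 / 2 := by rw [ht]; ring
      rw [h4]; nlinarith
    have h5 : t * (T / δ) = T * (t * (1 / δ)) := by ring
    nlinarith [mul_le_mul_of_nonneg_left h3 hT0]
  by_contra! hbad
  have hN : 0 < ((k : ℝ) ^ n) ^ M := by positivity
  have hsum : ((k : ℝ) ^ n) ^ M ≤ ∑ S ∈ Finset.powersetCard k (Finset.univ : Finset (Fin n)),
      ∑ F : Fin M → Fin n → Fin k,
        (Real.exp (-(t * δ * T)) * Real.exp (t * injCount F S)
          + Real.exp (t * (T / δ)) * Real.exp (-t * injCount F S)) := by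
    rw [Finset.sum_comm]
    calc ((k : ℝ) ^ n) ^ M = ∑ _F : Fin M → Fin n → Fin k, (1 : ℝ) := by simp
      _ ≤ _ := by
        refine Finset.sum_le_sum fun F _ => ?_
        obtain ⟨S, hS, hSbad⟩ := hbad F
        refine (one_le_exp_add_exp_of_not_between ht0.le
          (fun h => absurd h.2 (not_le.2 (hSbad h.1)))).trans
          (Finset.single_le_sum (f := fun S =>
            Real.exp (-(t * δ * T)) * Real.exp (t * injCount F S)
              + Real.exp (t * (T / δ)) * Real.exp (-t * injCount F S))
            (fun S _ => by positivity) (Finset.mem_powersetCard.2 ⟨Finset.subset_univ S, hS⟩))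
  have hterm : ∀ S ∈ Finset.powersetCard k (Finset.univ : Finset (Fin n)),
      ∑ F : Fin M → Fin n → Fin k,
        (Real.exp (-(t * δ * T)) * Real.exp (t * injCount F S)
          + Real.exp (t * (T / δ)) * Real.exp (-t * injCount F S))
      ≤ ((k : ℝ) ^ n) ^ M * (2 * B) := by
    intro S hS
    have hS := (Finset.mem_powersetCard.1 hS).2
    rw [Finset.sum_add_distrib, ← Finset.mul_sum, ← Finset.mul_sum]
    have h1 := mul_le_mul_of_nonneg_left (sum_exp_mul_injCount_le hk hkn M S hS t)
      (Real.exp_pos (-(t * δ * T))).le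
    have h2 := mul_le_mul_of_nonneg_left (sum_exp_mul_injCount_le hk hkn M S hS (-t))
      (Real.exp_pos (t * (T / δ))).le
    have h3 := mul_le_mul_of_nonneg_left hup hN.le
    have h4 := mul_le_mul_of_nonneg_left hlow hN.le
    linarith
  have htot := hsum.trans (Finset.sum_le_sum hterm)
  rw [Finset.sum_const, Finset.card_powersetCard, Finset.card_fin, nsmul_eq_mul] at htot
  have hn0 : (0 : ℝ) < n := by positivity
  have hBval : B = ((n : ℝ) ^ k)⁻¹ * Real.exp (-1) := by
    rw [hB, neg_add, Real.exp_add, Real.exp_neg, Real.exp_nat_mul, Real.exp_log hn0]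
  have hchoose : (n.choose k : ℝ) * B ≤ Real.exp (-1) := by
    have hc : (n.choose k : ℝ) ≤ (n : ℝ) ^ k := by exact_mod_cast Nat.choose_le_pow n k
    rw [hBval, ← mul_assoc]
    refine mul_le_of_le_one_left (Real.exp_pos _).le ?_
    rw [← div_eq_mul_inv]
    exact div_le_one_of_le₀ hc (by positivity)
  have he : Real.exp (-1) < 1 / 2 := by linarith [Real.exp_neg_one_lt_d9]
  nlinarith [mul_lt_mul_of_pos_left (hchoose.trans_lt he) hN]
end

section
/- For all integers 2 ≤ k ≤ n and every real 1 < δ ≤ 2, setting p = binom(k, ⌈k/2⌉)/2^k and M = ⌈8(k·ln n + 1)/(p·(δ−1)²)⌉, there exist M functions from [n] to [2] such that for every S ⊆ [n] with |S| = k, the number of these functions h with |h⁻¹(1) ∩ S| = ⌈k/2⌉ and |h⁻¹(2) ∩ S| = ⌊k/2⌋ is between pM/δ and δpM; in particular there exists a δ-balanced (n,k,2)-splitter of size M. -/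
open Finset

attribute [local instance] Classical.propDecidable

/-- `p = binom(k,⌈k/2⌉)/2^k`, the probability that a uniformly random function from a fixed
`k`-element set to `{1,2}` maps exactly `⌈k/2⌉` elements to `1`. -/
noncomputable def pHalf (k : ℕ) : ℝ := (Nat.choose k ((k + 1) / 2) : ℝ) / 2 ^ k

/-- `M = ⌈8(k·ln n + 1)/(p·(δ−1)²)⌉`. -/
noncomputable def MHalf (n k : ℕ) (δ : ℝ) : ℕ :=
  ⌈(8 * ((k : ℝ) * Real.log n + 1)) / (pHalf k * (δ - 1) ^ 2)⌉₊

/-- The exponential moment of the number of coordinates of `F : Fin M → α` lying in `A`. -/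
theorem sum_exp_count {α : Type*} [Fintype α] (A : Finset α) (M : ℕ) (t : ℝ) :
    ∑ F : Fin M → α, Real.exp (t * ((univ.filter fun i => F i ∈ A).card : ℝ)) =
      ((Fintype.card α : ℝ) + (A.card : ℝ) * (Real.exp t - 1)) ^ M := by
  have h1 : ∑ a : α, (if a ∈ A then Real.exp t else 1) =
      (Fintype.card α : ℝ) + (A.card : ℝ) * (Real.exp t - 1) := by
    have h (a : α) : (if a ∈ A then Real.exp t else 1) =
        1 + (if a ∈ A then Real.exp t - 1 else 0) := by
      split_ifs <;> ring
    simp_rw [h]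
    rw [sum_add_distrib]
    simp [Finset.sum_ite_mem, mul_sub]
  rw [← h1, Fintype.sum_pow]
  refine sum_congr rfl fun F _ => ?_
  rw [prod_ite, prod_const, prod_const_one, mul_one, ← Real.exp_nat_mul, mul_comm]

/-- Exponential Markov inequality for the number of coordinates of `F : Fin M → α` in `A`. -/
theorem card_count_le_exp {α : Type*} [Fintype α] (A : Finset α) (M : ℕ) (p t a : ℝ)
    (hA : (A.card : ℝ) = p * Fintype.card α) :
    ((univ.filter fun F : Fin M → α =>
        t * a ≤ t * ((univ.filter fun i => F i ∈ A).card : ℝ)).card : ℝ) ≤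
      (Fintype.card α : ℝ) ^ M * Real.exp (p * M * (Real.exp t - 1) - t * a) := by
  have hmarkov : ((univ.filter fun F : Fin M → α =>
        t * a ≤ t * ((univ.filter fun i => F i ∈ A).card : ℝ)).card : ℝ) * Real.exp (t * a) ≤
      ((Fintype.card α : ℝ) + (A.card : ℝ) * (Real.exp t - 1)) ^ M := by
    rw [← sum_exp_count, ← nsmul_eq_mul, ← sum_const]
    refine (sum_le_sum fun F hF => Real.exp_le_exp.2 (mem_filter.1 hF).2).trans ?_
    exact sum_le_sum_of_subset_of_nonneg (filter_subset _ _) fun _ _ _ => (Real.exp_pos _).le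
  have hmoment : ((Fintype.card α : ℝ) + (A.card : ℝ) * (Real.exp t - 1)) ^ M ≤
      (Fintype.card α : ℝ) ^ M * Real.exp (p * M * (Real.exp t - 1)) := by
    have hnonneg : 0 ≤ (Fintype.card α : ℝ) + (A.card : ℝ) * (Real.exp t - 1) := by
      have : (A.card : ℝ) ≤ Fintype.card α := by exact_mod_cast A.card_le_univ
      nlinarith [Real.exp_pos t, (Nat.cast_nonneg A.card : (0 : ℝ) ≤ A.card)]
    have hle : (Fintype.card α : ℝ) + (A.card : ℝ) * (Real.exp t - 1) ≤
        Fintype.card α * Real.exp (p * (Real.exp t - 1)) := by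
      rw [hA]
      nlinarith [Real.add_one_le_exp (p * (Real.exp t - 1)),
        (Nat.cast_nonneg (Fintype.card α) : (0 : ℝ) ≤ Fintype.card α)]
    refine (pow_le_pow_left₀ hnonneg hle M).trans_eq ?_
    rw [mul_pow, ← Real.exp_nat_mul]
    ring_nf
  rw [Real.exp_sub, ← mul_div_assoc, le_div_iff₀ (Real.exp_pos _)]
  exact hmarkov.trans hmoment

theorem exp_neg_le_quadratic {s : ℝ} (hs : 0 ≤ s) : Real.exp (-s) ≤ 1 - s + s ^ 2 / 2 := by
  rw [Real.exp_neg, inv_le_iff_one_le_mul₀ (Real.exp_pos s)]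
  have h : 0 ≤ 1 - s + s ^ 2 / 2 := by nlinarith [sq_nonneg (s - 1)]
  nlinarith [mul_le_mul_of_nonneg_left (Real.quadratic_le_exp_of_nonneg hs) h,
    sq_nonneg (s ^ 2)]

/-- Upper-tail Chernoff bound. -/
theorem card_upper_tail_le {α : Type*} [Fintype α] (A : Finset α) (M : ℕ) (p δ L : ℝ)
    (hA : (A.card : ℝ) = p * Fintype.card α) (hδ1 : 1 < δ) (hδ2 : δ ≤ 2)
    (hp : 0 ≤ p) (hL : 8 * L ≤ p * M * (δ - 1) ^ 2) :
    ((univ.filter fun F : Fin M → α =>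
        δ * (p * M) < ((univ.filter fun i => F i ∈ A).card : ℝ)).card : ℝ) ≤
      (Fintype.card α : ℝ) ^ M * Real.exp (-L) := by
  have hμ : 0 ≤ p * M := by positivity
  have ht : 0 ≤ (δ - 1) / 2 := by linarith
  have h := card_count_le_exp A M p ((δ - 1) / 2) (δ * (p * M)) hA
  refine le_trans ?_ (h.trans ?_)
  · refine Nat.cast_le.2 (card_le_card fun F hF => ?_)
    simp only [mem_filter, mem_univ, true_and] at hF ⊢
    exact mul_le_mul_of_nonneg_left hF.le ht
  · gcongr
    have hexp := (abs_le.1 (Real.abs_exp_sub_one_sub_id_le (x := (δ - 1) / 2)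
      (by rw [abs_le]; constructor <;> linarith))).2
    nlinarith [mul_le_mul_of_nonneg_left hexp hμ, mul_nonneg hμ (sq_nonneg (δ - 1))]

/-- Lower-tail Chernoff bound. -/
theorem card_lower_tail_le {α : Type*} [Fintype α] (A : Finset α) (M : ℕ) (p δ L : ℝ)
    (hA : (A.card : ℝ) = p * Fintype.card α) (hδ1 : 1 < δ) (hδ2 : δ ≤ 2)
    (hp : 0 ≤ p) (hL : 8 * L ≤ p * M * (δ - 1) ^ 2) :
    ((univ.filter fun F : Fin M → α =>
        ((univ.filter fun i => F i ∈ A).card : ℝ) < p * M / δ).card : ℝ) ≤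
      (Fintype.card α : ℝ) ^ M * Real.exp (-L) := by
  have hμ : 0 ≤ p * M := by positivity
  have hη : (δ - 1) / 2 ≤ 1 - 1 / δ := by
    rw [← sub_nonneg]
    have : 1 - 1 / δ - (δ - 1) / 2 = (δ - 1) * (2 - δ) / (2 * δ) := by
      field_simp
    rw [this]
    exact div_nonneg (mul_nonneg (by linarith) (by linarith)) (by linarith)
  set η := 1 - 1 / δ with hη_def
  have hη0 : 0 ≤ η := by linarith
  have h := card_count_le_exp A M p (-η) (p * M / δ) hA
  refine le_trans ?_ (h.trans ?_)
  · refine Nat.cast_le.2 (card_le_card fun F hF => ?_)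
    simp only [mem_filter, mem_univ, true_and] at hF ⊢
    exact mul_le_mul_of_nonpos_left hF.le (by linarith)
  · gcongr
    have hdiv : p * M / δ = p * M * (1 - η) := by
      rw [hη_def]
      ring
    have hsq : ((δ - 1) / 2) ^ 2 ≤ η ^ 2 := pow_le_pow_left₀ (by linarith) hη 2
    rw [hdiv]
    nlinarith [mul_le_mul_of_nonneg_left (exp_neg_le_quadratic hη0) hμ,
      mul_le_mul_of_nonneg_left hsq hμ]

/-- Union bound: some `F` meets every `A s` in the expected number of coordinates, up to the
factor `δ`. -/
theorem exists_balanced {α ι : Type*} [Fintype α] [Nonempty α] (I : Finset ι)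
    (A : ι → Finset α) (M : ℕ) (p δ L : ℝ)
    (hA : ∀ s ∈ I, ((A s).card : ℝ) = p * Fintype.card α) (hδ1 : 1 < δ) (hδ2 : δ ≤ 2)
    (hp : 0 ≤ p) (hL : 8 * L ≤ p * M * (δ - 1) ^ 2) (hI : I.card * (2 * Real.exp (-L)) < 1) :
    ∃ F : Fin M → α, ∀ s ∈ I,
      p * M / δ ≤ ((univ.filter fun i => F i ∈ A s).card : ℝ) ∧
      ((univ.filter fun i => F i ∈ A s).card : ℝ) ≤ δ * (p * M) := by
  by_contra! hbad
  have hcover : (univ : Finset (Fin M → α)) ⊆ I.biUnion fun s =>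
      (univ.filter fun F : Fin M → α =>
        ((univ.filter fun i => F i ∈ A s).card : ℝ) < p * M / δ) ∪
      (univ.filter fun F : Fin M → α =>
        δ * (p * M) < ((univ.filter fun i => F i ∈ A s).card : ℝ)) := by
    intro F _
    obtain ⟨s, hs, h⟩ := hbad F
    simp only [mem_biUnion, mem_union, mem_filter, mem_univ, true_and]
    exact ⟨s, hs, (lt_or_ge _ _).imp_right h⟩
  have hcard : ((Fintype.card α : ℝ) ^ M) ≤
      I.card * (2 * ((Fintype.card α : ℝ) ^ M * Real.exp (-L))) := by
    have h := (card_le_card hcover).trans card_biUnion_le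
    rw [card_univ, Fintype.card_fun, Fintype.card_fin] at h
    have h' := (Nat.cast_le (α := ℝ)).2 h
    rw [Nat.cast_pow] at h'
    refine h'.trans ?_
    rw [Nat.cast_sum]
    rw [← nsmul_eq_mul, ← sum_const]
    refine sum_le_sum fun s hs => ?_
    refine (Nat.cast_le.2 (card_union_le _ _)).trans ?_
    push_cast
    have h1 := card_lower_tail_le (A s) M p δ L (hA s hs) hδ1 hδ2 hp hL
    have h2 := card_upper_tail_le (A s) M p δ L (hA s hs) hδ1 hδ2 hp hL
    linarith
  have hpos : (0 : ℝ) < (Fintype.card α : ℝ) ^ M := by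
    have : 0 < Fintype.card α := Fintype.card_pos
    positivity
  nlinarith

/-- The number of subsets of `α` meeting `S` in exactly `j` elements. -/
theorem card_filter_card_inter {α : Type*} [Fintype α] (S : Finset α) (j : ℕ) :
    ((univ : Finset (Finset α)).filter fun B => (S ∩ B).card = j).card =
      S.card.choose j * 2 ^ (Fintype.card α - S.card) := by
  rw [← card_compl, ← card_powersetCard, ← card_powerset, ← card_product]
  refine card_nbij' (fun B => (S ∩ B, Sᶜ ∩ B)) (fun P => P.1 ∪ P.2) ?_ ?_ ?_ ?_
  · intro B hB
    simp_all [mem_powersetCard]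
  · rintro ⟨P, Q⟩ h
    simp only [coe_product, Set.mem_prod, mem_coe, mem_powersetCard, mem_powerset] at h
    obtain ⟨⟨hP, hj⟩, hQ⟩ := h
    simp only [coe_filter, mem_univ, true_and, Set.mem_ofPred_eq]
    rw [← hj]
    congr 1
    ext x
    have := @hP x
    have := @hQ x
    simp only [mem_inter, mem_union, mem_compl] at *
    tauto
  · intro B _
    ext x
    simp only [mem_inter, mem_union, mem_compl]
    tauto
  · rintro ⟨P, Q⟩ h
    simp only [coe_product, Set.mem_prod, mem_coe, mem_powersetCard, mem_powerset] at h
    obtain ⟨⟨hP, -⟩, hQ⟩ := h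
    ext x <;>
    · have := @hP x
      have := @hQ x
      simp only [mem_inter, mem_union, mem_compl] at *
      tauto

/-- The number of two-colorings giving exactly `j` elements of `S` the color `0`. -/
theorem card_colorings {n : ℕ} (S : Finset (Fin n)) (j : ℕ) :
    ((univ : Finset (Fin n → Fin 2)).filter fun h => (S.filter fun x => h x = 0).card = j).card =
      S.card.choose j * 2 ^ (n - S.card) := by
  have := card_filter_card_inter S j
  rw [Fintype.card_fin] at this
  rw [← this]
  refine card_nbij' (fun h => univ.filter fun x => h x = 0) (fun B x => if x ∈ B then 0 else 1)
    ?_ ?_ ?_ ?_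
  · intro h hh
    simpa [inter_filter] using hh
  · intro B hB
    simp only [coe_filter, mem_univ, true_and, Set.mem_ofPred_eq] at hB ⊢
    rw [← hB]
    congr 1
    ext x
    simp
  · intro h _
    funext x
    by_cases hx : h x = 0
    · simp [hx]
    · simp only [mem_filter, mem_univ, true_and, hx, if_false]
      omega
  · intro B _
    ext x
    simp

theorem card_filter_fin_two {n : ℕ} (S : Finset (Fin n)) (h : Fin n → Fin 2) :
    (S.filter fun x => h x = 0).card + (S.filter fun x => h x = 1).card = S.card := by
  rw [← card_filter_add_card_filter_not (s := S) (fun x => h x = 0)]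
  congr 2
  refine filter_congr fun x _ => ?_
  omega

theorem pHalf_pos (k : ℕ) : 0 < pHalf k := by
  have : 0 < k.choose ((k + 1) / 2) := Nat.choose_pos (by omega)
  unfold pHalf
  positivity

/-- for `2 ≤ k ≤ n` and `1 < δ ≤ 2`, with `p = binom(k,⌈k/2⌉)/2^k` and
`M = ⌈8(k ln n + 1)/(p(δ−1)²)⌉`, there exist `M` functions from `[n]` to `[2]` such that
for every `k`-set `S ⊆ [n]` the number of these functions `h` with
`|h⁻¹(1) ∩ S| = ⌈k/2⌉` and `|h⁻¹(2) ∩ S| = ⌊k/2⌋` is between `pM/δ` and `δpM`; in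
particular this is a `δ`-balanced `(n,k,2)`-splitter of size `M`. Here the element
`0 : Fin 2` plays the role of the color `1` and `1 : Fin 2` plays the role of `2`. -/
theorem stmt4 (n k : ℕ) (hk : 2 ≤ k) (hkn : k ≤ n)
    (δ : ℝ) (hδ1 : 1 < δ) (hδ2 : δ ≤ 2) :
    ∃ F : Fin (MHalf n k δ) → Fin n → Fin 2,
      ∀ S : Finset (Fin n), S.card = k →
        pHalf k * (MHalf n k δ : ℝ) / δ ≤
          ((Finset.univ.filter fun i : Fin (MHalf n k δ) =>
            (S.filter fun x => F i x = 0).card = (k + 1) / 2 ∧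
            (S.filter fun x => F i x = 1).card = k / 2).card : ℝ) ∧
        ((Finset.univ.filter fun i : Fin (MHalf n k δ) =>
            (S.filter fun x => F i x = 0).card = (k + 1) / 2 ∧
            (S.filter fun x => F i x = 1).card = k / 2).card : ℝ) ≤
          δ * (pHalf k * (MHalf n k δ : ℝ)) := by
  have hp := pHalf_pos k
  have hδ : 0 < (δ - 1) ^ 2 := pow_pos (by linarith) 2
  have hn : (0 : ℝ) < n := by exact_mod_cast (by omega : 0 < n)
  have hL : 8 * ((k : ℝ) * Real.log n + 1) ≤ pHalf k * (MHalf n k δ) * (δ - 1) ^ 2 := by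
    have h : _ ≤ (MHalf n k δ : ℝ) := Nat.le_ceil _
    rw [div_le_iff₀ (mul_pos hp hδ)] at h
    linarith
  have hI : ((powersetCard k (univ : Finset (Fin n))).card : ℝ) *
      (2 * Real.exp (-((k : ℝ) * Real.log n + 1))) < 1 := by
    rw [card_powersetCard, card_univ, Fintype.card_fin, neg_add, Real.exp_add, Real.exp_neg,
      Real.exp_nat_mul, Real.exp_log hn]
    have hchoose : (n.choose k : ℝ) ≤ (n : ℝ) ^ k := by exact_mod_cast Nat.choose_le_pow n k
    have hnk : (0 : ℝ) < (n : ℝ) ^ k := by positivity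
    have hratio : (n.choose k : ℝ) * ((n : ℝ) ^ k)⁻¹ ≤ 1 := by
      rw [← div_eq_mul_inv]
      exact (div_le_one hnk).2 hchoose
    have he : 2 * Real.exp (-1) < 1 := by linarith [Real.exp_neg_one_lt_half]
    nlinarith [Real.exp_pos (-1)]
  have hA : ∀ S ∈ powersetCard k (univ : Finset (Fin n)),
      (((univ : Finset (Fin n → Fin 2)).filter fun h =>
        (S.filter fun x => h x = 0).card = (k + 1) / 2).card : ℝ) =
      pHalf k * Fintype.card (Fin n → Fin 2) := by
    intro S hS
    have hSk := (mem_powersetCard.1 hS).2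
    rw [card_colorings, hSk, Fintype.card_fun, Fintype.card_fin, Fintype.card_fin, pHalf,
      ← Nat.sub_add_cancel hkn, Nat.add_sub_cancel]
    push_cast
    rw [pow_add]
    field_simp
  obtain ⟨F, hF⟩ := exists_balanced (powersetCard k (univ : Finset (Fin n))) _ (MHalf n k δ)
    (pHalf k) δ _ hA hδ1 hδ2 hp.le hL hI
  refine ⟨F, fun S hS => ?_⟩
  have hiff (i : Fin (MHalf n k δ)) :
      ((S.filter fun x => F i x = 0).card = (k + 1) / 2 ∧
        (S.filter fun x => F i x = 1).card = k / 2) ↔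
      F i ∈ ((univ : Finset (Fin n → Fin 2)).filter fun h =>
        (S.filter fun x => h x = 0).card = (k + 1) / 2) := by
    have := card_filter_fin_two S (F i)
    simp only [mem_filter, mem_univ, true_and]
    omega
  simp only [hiff]
  convert hF S (mem_powersetCard.2 ⟨subset_univ _, hS⟩)
end

section
/- Let 1 ≤ k ≤ n be integers, let 1 < δ ≤ 2 be real, and set q = ⌈2k²/(δ−1)⌉. Suppose f_1,…,f_M are functions from [n] to [q] such that for every pair of distinct elements x, y ∈ [n], the number of indices i ∈ [M] with f_i(x) = f_i(y) is at most (2/q)·M (equivalently, the n codewords (f_1(x),…,f_M(x)) form a code of length M over alphabet [q] with normalized Hamming distance at least 1 − 2/q). Then for every S ⊆ [n] with |S| = k, the number of indices i such that f_i is injective on S is at least M/δ (and trivially at most M ≤ δM); hence the multiset {f_1,…,f_M} is a δ-balanced (n,k,q)-splitter with witnessing constant T = M. -/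
open Finset

attribute [local instance] Classical.propDecidable

/-- A union bound over pairs: if any two distinct points collide under at most `c` of the
functions, then at most `(#S choose 2) * c` of the functions fail to be injective on `S`. -/
theorem card_not_injOn_le {α β ι : Type*} [DecidableEq β] [Fintype ι] (F : ι → α → β)
    (S : Finset α) (c : ℝ)
    (h : ∀ x y : α, x ≠ y → ((Finset.univ.filter fun i => F i x = F i y).card : ℝ) ≤ c) :
    ((Finset.univ.filter fun i => ¬ Set.InjOn (F i) ↑S).card : ℝ) ≤ S.card.choose 2 * c := by
  have hsub : (Finset.univ.filter fun i => ¬ Set.InjOn (F i) ↑S) ⊆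
      (S.powersetCard 2).biUnion fun p =>
        Finset.univ.filter fun i => ¬ Set.InjOn (F i) (p : Set α) := by
    intro i hi
    simp only [Finset.mem_filter, Finset.mem_univ, true_and, Set.InjOn, not_forall] at hi
    obtain ⟨x, hx, y, hy, hxy, hne⟩ := hi
    simp only [Finset.mem_biUnion, Finset.mem_filter, Finset.mem_univ, true_and]
    refine ⟨{x, y}, Finset.mem_powersetCard.2 ⟨?_, Finset.card_pair hne⟩, fun hinj => ?_⟩
    · exact Finset.insert_subset hx (Finset.singleton_subset_iff.2 hy)
    · exact hne (hinj (by simp) (by simp) hxy)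
  have hpair : ∀ p ∈ S.powersetCard 2,
      ((Finset.univ.filter fun i => ¬ Set.InjOn (F i) (p : Set α)).card : ℝ) ≤ c := by
    intro p hp
    obtain ⟨x, y, hne, rfl⟩ := Finset.card_eq_two.1 (Finset.mem_powersetCard.1 hp).2
    refine le_trans (Nat.cast_le.2 (Finset.card_le_card fun i hi => ?_)) (h x y hne)
    simp only [Finset.mem_filter, Finset.mem_univ, true_and] at hi ⊢
    contrapose! hi
    rw [Finset.coe_pair, Set.injOn_pair]
    exact fun hxy => absurd hxy hi
  calc ((Finset.univ.filter fun i => ¬ Set.InjOn (F i) ↑S).card : ℝ)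
      ≤ ∑ p ∈ S.powersetCard 2,
          ((Finset.univ.filter fun i => ¬ Set.InjOn (F i) (p : Set α)).card : ℝ) := by
        exact_mod_cast (Finset.card_le_card hsub).trans Finset.card_biUnion_le
    _ ≤ (S.powersetCard 2).card • c := Finset.sum_le_card_nsmul _ _ _ hpair
    _ = S.card.choose 2 * c := by rw [Finset.card_powersetCard, nsmul_eq_mul]

theorem injCount_le_card {α β ι : Type*} [Fintype ι] (F : ι → α → β) (S : Finset α) :
    injCount F S ≤ Fintype.card ι :=
  Finset.card_le_univ _

theorem card_sub_le_injCount {α β ι : Type*} [DecidableEq β] [Fintype ι] (F : ι → α → β)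
    (S : Finset α) (c : ℝ)
    (h : ∀ x y : α, x ≠ y → ((Finset.univ.filter fun i => F i x = F i y).card : ℝ) ≤ c) :
    (Fintype.card ι : ℝ) - S.card.choose 2 * c ≤ injCount F S := by
  have hbad := card_not_injOn_le F S c h
  have hsplit : injCount F S + (Finset.univ.filter fun i => ¬ Set.InjOn (F i) ↑S).card =
      Fintype.card ι := by
    rw [injCount, ← Finset.card_univ]
    convert Finset.card_filter_add_card_filter_not (s := (Finset.univ : Finset ι))
      (fun i => Set.InjOn (F i) (S : Set α))
  have : (injCount F S : ℝ) +
      ((Finset.univ.filter fun i => ¬ Set.InjOn (F i) ↑S).card : ℝ) = Fintype.card ι := by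
    exact_mod_cast hsplit
  linarith

/-- let `q = ⌈2k²/(δ−1)⌉` and let `f_1,…,f_M : [n] → [q]` be such that any two
distinct elements of `[n]` collide in at most `(2/q)·M` coordinates (i.e. the corresponding
codewords form a code of normalized Hamming distance at least `1 − 2/q`). Then for every
`k`-set `S ⊆ [n]`, at least `M/δ` (and trivially at most `δM`) of the functions are injective
on `S`; hence the family is a `δ`-balanced `(n,k,q)`-splitter with witnessing constant
`T = M` (note `q ≥ k`, so `split(S)` counts functions injective on `S`). -/
theorem stmt5 (n k M : ℕ) (hk : 1 ≤ k) (hkn : k ≤ n)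
    (δ : ℝ) (hδ1 : 1 < δ) (hδ2 : δ ≤ 2)
    (F : Fin M → Fin n → Fin ⌈2 * (k : ℝ) ^ 2 / (δ - 1)⌉₊)
    (hdist : ∀ x y : Fin n, x ≠ y →
      ((Finset.univ.filter fun i : Fin M => F i x = F i y).card : ℝ) ≤
        (2 / (⌈2 * (k : ℝ) ^ 2 / (δ - 1)⌉₊ : ℝ)) * M) :
    ∀ S : Finset (Fin n), S.card = k →
      (M : ℝ) / δ ≤ (injCount F S : ℝ) ∧ (injCount F S : ℝ) ≤ δ * (M : ℝ) := by
  intro S hS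
  have hδ : 0 < δ - 1 := by linarith
  have hk0 : (0 : ℝ) < k := by exact_mod_cast hk
  have hM : (0 : ℝ) ≤ M := M.cast_nonneg
  have hinj := card_sub_le_injCount F S _ hdist
  rw [hS, Nat.cast_choose_two, Fintype.card_fin] at hinj
  have hq := Nat.le_ceil (2 * (k : ℝ) ^ 2 / (δ - 1))
  clear hdist
  generalize (⌈2 * (k : ℝ) ^ 2 / (δ - 1)⌉₊ : ℝ) = q at hinj hq
  have hq0 : 0 < q := lt_of_lt_of_le (by positivity) hq
  rw [div_le_iff₀ hδ] at hq
  have hsmall : (k : ℝ) * (k - 1) / 2 * (2 / q * M) ≤ (δ - 1) / 2 * M := by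
    have : (k : ℝ) * (k - 1) / q ≤ (δ - 1) / 2 := by
      rw [div_le_iff₀ hq0]
      nlinarith
    calc (k : ℝ) * (k - 1) / 2 * (2 / q * M) = k * (k - 1) / q * M := by ring
      _ ≤ (δ - 1) / 2 * M := by gcongr
  constructor
  · rw [div_le_iff₀ (by linarith)]
    have hlower : (M : ℝ) - (δ - 1) / 2 * M ≤ injCount F S := by linarith
    have hprod : 0 ≤ (M : ℝ) * ((δ - 1) * (2 - δ)) :=
      mul_nonneg hM (mul_nonneg hδ.le (by linarith))
    nlinarith [mul_le_mul_of_nonneg_right hlower (by linarith : (0 : ℝ) ≤ δ)]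
  · have hle : (injCount F S : ℝ) ≤ M := by
      exact_mod_cast (injCount_le_card F S).trans_eq (Fintype.card_fin M)
    nlinarith
end

section
/- Let 2 ≤ l ≤ k ≤ n be integers, let 1 < δ ≤ 2 be real, let m = ⌈log₂ l⌉, and let ε = 2^{−km−1}·(δ−1). Let Ω be a finite set equipped with the uniform probability measure and let X_1,…,X_{nm} : Ω → {0,1} be (ε, km)-independent random variables. Fix any surjection φ : {0,1}^m → [l], and for each ω ∈ Ω define f_ω : [n] → [l] by f_ω(x) = φ(X_{(x−1)m+1}(ω),…,X_{xm}(ω)). Let p be the probability that, for km independent unbiased uniform bits grouped into k blocks of m bits each and mapped by φ to values in [l], exactly ⌈k/l⌉ blocks take each value j for 1 ≤ j ≤ (k mod l) and exactly ⌊k/l⌋ blocks take each value j for (k mod l) < j ≤ l. Then p > 0 and, for every S ⊆ [n] with |S| = k, the number split(S) of ω ∈ Ω with |f_ω⁻¹(j) ∩ S| = ⌈k/l⌉ for 1 ≤ j ≤ (k mod l) and |f_ω⁻¹(j) ∩ S| = ⌊k/l⌋ for (k mod l) < j ≤ l satisfies (1 − (δ−1)/2)·p·|Ω| ≤ split(S)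 ≤ (1 + (δ−1)/2)·p·|Ω|; consequently p|Ω|/δ ≤ split(S) ≤ δ·p|Ω|, so the multiset {f_ω : ω ∈ Ω} is a δ-balanced (n,k,l)-splitter. -/
open Finset

attribute [local instance] Classical.propDecidable

/-- The index, inside `[n·m]`, of the `t`-th bit of the `x`-th block of `m` bits. -/
def blockIdx {n m : ℕ} (x : Fin n) (t : Fin m) : Fin (n * m) :=
  ⟨(x : ℕ) * m + (t : ℕ), by
    calc (x : ℕ) * m + (t : ℕ) < (x : ℕ) * m + m := by omega
      _ = ((x : ℕ) + 1) * m := by ring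
      _ ≤ n * m := Nat.mul_le_mul_right m x.isLt⟩

/-- The size of the `j`-th part: `⌈k/l⌉` for the first `k mod l` parts and `⌊k/l⌋` for the
remaining ones. -/
def target (k l : ℕ) (j : Fin l) : ℕ :=
  if (j : ℕ) < k % l then (k + l - 1) / l else k / l

/-- `p`: the probability that `k·m` independent unbiased uniform bits, grouped into `k` blocks
of `m` bits each and mapped by `φ` to values in `[l]`, realize exactly the target number of
blocks of each value. -/
noncomputable def pBlocks (k l m : ℕ) (φ : (Fin m → Fin 2) → Fin l) : ℝ :=
  ((Finset.univ.filter fun b : Fin k → Fin m → Fin 2 =>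
      ∀ j : Fin l, (Finset.univ.filter fun i : Fin k => φ (b i) = j).card = target k l j).card : ℝ)
    / 2 ^ (k * m)

/-- The number of `i < k` congruent to `j` modulo `l` is the target size of the `j`-th part. -/
lemma card_filter_mod_eq_target (k l : ℕ) (hl : 0 < l) (j : Fin l) :
    (Finset.univ.filter fun i : Fin k => (⟨i % l, Nat.mod_lt _ hl⟩ : Fin l) = j).card =
      target k l j := by
  have hcount : (Finset.univ.filter fun i : Fin k => (⟨i % l, Nat.mod_lt _ hl⟩ : Fin l) = j).card =
      k.count (· ≡ (j : ℕ) [MOD l]) := by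
    rw [Nat.count_eq_card_filter_range, ← Finset.card_map Fin.valEmbedding]
    congr 1
    ext i
    simp only [Finset.mem_map, Finset.mem_filter, Finset.mem_univ, true_and, Finset.mem_range,
      Fin.valEmbedding_apply, Fin.ext_iff, Nat.ModEq, Nat.mod_eq_of_lt j.isLt]
    exact ⟨by rintro ⟨a, ha, rfl⟩; exact ⟨a.isLt, ha⟩, fun ⟨hi, h⟩ => ⟨⟨i, hi⟩, h, rfl⟩⟩
  rw [hcount, Nat.count_modEq_card k hl, Nat.mod_eq_of_lt j.isLt, target]
  split_ifs with h
  · have hk := Nat.div_add_mod k l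
    have hr := Nat.mod_lt k hl
    symm
    rw [Nat.div_eq_iff hl]
    have hq : (k / l + 1) * l = l * (k / l) + l := by ring
    have hpos : 0 < k % l := by omega
    generalize (k / l + 1) * l = x at *
    generalize l * (k / l) = y at *
    generalize k % l = r at *
    omega
  · rfl

lemma pBlocks_pos (k l m : ℕ) (hl : 0 < l) (φ : (Fin m → Fin 2) → Fin l)
    (hφ : Function.Surjective φ) : 0 < pBlocks k l m φ := by
  obtain ⟨g, hg⟩ := hφ.hasRightInverse
  refine div_pos (Nat.cast_pos.mpr (Finset.card_pos.mpr
    ⟨fun i => g ⟨i % l, Nat.mod_lt _ hl⟩, ?_⟩)) (by positivity)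
  simp only [Finset.mem_filter, Finset.mem_univ, true_and, hg _]
  exact card_filter_mod_eq_target k l hl

/-- Listing the bits of the blocks `e 0 < e 1 < ⋯` in order gives increasing positions. -/
lemma strictMono_blockIdx_divNat_modNat {n k m : ℕ} (e : Fin k → Fin n) (he : StrictMono e) :
    StrictMono fun t : Fin (k * m) => blockIdx (e t.divNat) t.modNat := by
  intro s t hst
  have hm : 0 < m := s.modNat.pos
  rw [Fin.lt_def] at hst
  change (e s.divNat : ℕ) * m + (s : ℕ) % m < (e t.divNat : ℕ) * m + (t : ℕ) % m
  have hs := Nat.div_add_mod (s : ℕ) m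
  have ht := Nat.div_add_mod (t : ℕ) m
  have hsm := Nat.mod_lt (s : ℕ) hm
  rcases (Nat.div_le_div_right (c := m) hst.le).lt_or_eq with h | h
  · have hlt : (e s.divNat : ℕ) < e t.divNat := he (Fin.lt_def.mpr h)
    have hmul := Nat.mul_le_mul_right m (Nat.succ_le_of_lt hlt)
    rw [Nat.succ_mul] at hmul
    linarith [Nat.zero_le ((t : ℕ) % m)]
  · have heq : s.divNat = t.divNat := Fin.ext h
    rw [heq]
    rw [h] at hs
    linarith

/-- Almost independent bits, read in blocks at increasing block positions, attain every pattern
of blocks with almost the uniform frequency. -/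
lemma abs_card_filter_blocks_sub_lt {Ω : Type*} [Fintype Ω] {n k m : ℕ}
    (X : Fin (n * m) → Ω → Fin 2) (q ε : ℝ)
    (hX : ∀ ι : Fin (k * m) → Fin (n * m), StrictMono ι → ∀ α : Fin (k * m) → Fin 2,
      |((Finset.univ.filter fun ω : Ω => ∀ t, X (ι t) ω = α t).card : ℝ) /
        (Fintype.card Ω : ℝ) - q| < ε)
    (e : Fin k → Fin n) (he : StrictMono e) (b : Fin k → Fin m → Fin 2) :
    |((Finset.univ.filter fun ω : Ω => (fun i t => X (blockIdx (e i) t) ω) = b).card : ℝ) /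
      (Fintype.card Ω : ℝ) - q| < ε := by
  have hB : (Finset.univ.filter fun ω : Ω => ∀ t : Fin (k * m),
      X (blockIdx (e t.divNat) t.modNat) ω = b t.divNat t.modNat) =
      Finset.univ.filter fun ω => (fun i t => X (blockIdx (e i) t) ω) = b := by
    ext ω
    simp only [Finset.mem_filter, Finset.mem_univ, true_and]
    refine ⟨fun h => ?_, fun h t => by rw [← h]⟩
    funext i t
    have := h (finProdFinEquiv (i, t))
    have hit : ((finProdFinEquiv (i, t)).divNat, (finProdFinEquiv (i, t)).modNat) = (i, t) :=
      finProdFinEquiv.symm_apply_apply (i, t)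
    rw [Prod.mk.injEq] at hit
    rwa [hit.1, hit.2] at this
  rw [← hB]
  exact hX _ (strictMono_blockIdx_divNat_modNat e he) fun t => b t.divNat t.modNat

/-- Counting a condition on the block values of `ω`: if every block pattern is attained with
frequency within `ε` of `q`, then a set of patterns `G` is attained with frequency within
`G.card * ε` of `G.card * q`. -/
lemma abs_card_filter_mem_sub_le {Ω β : Type*} [Fintype Ω] (B : Ω → β) (G : Finset β) (q ε : ℝ)
    (h : ∀ b ∈ G, |((Finset.univ.filter fun ω => B ω = b).card : ℝ) - q| ≤ ε) :
    |((Finset.univ.filter fun ω => B ω ∈ G).card : ℝ) - G.card * q| ≤ G.card * ε := by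
  have hsum : ((Finset.univ.filter fun ω => B ω ∈ G).card : ℝ) =
      ∑ b ∈ G, ((Finset.univ.filter fun ω => B ω = b).card : ℝ) := by
    rw [Finset.card_eq_sum_card_fiberwise (f := B) (t := G) (fun ω hω => by simpa using hω)]
    push_cast
    refine Finset.sum_congr rfl fun b hb => ?_
    congr 2
    ext ω
    simp only [Finset.mem_filter, Finset.mem_univ, true_and, and_iff_right_iff_imp]
    rintro rfl
    exact hb
  calc |((Finset.univ.filter fun ω => B ω ∈ G).card : ℝ) - G.card * q|
      = |∑ b ∈ G, (((Finset.univ.filter fun ω => B ω = b).card : ℝ) - q)| := by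
        rw [hsum, Finset.sum_sub_distrib, Finset.sum_const, nsmul_eq_mul]
    _ ≤ ∑ b ∈ G, |((Finset.univ.filter fun ω => B ω = b).card : ℝ) - q| :=
        Finset.abs_sum_le_sum_abs _ _
    _ ≤ G.card * ε := by
        simpa [nsmul_eq_mul] using Finset.sum_le_card_nsmul G _ ε h

/-- from `(ε, km)`-independent bits with `ε = 2^{−km−1}(δ−1)`, grouped into
blocks of `m = ⌈log₂ l⌉` bits and mapped by a surjection `φ` onto `[l]`, one obtains for each
`ω ∈ Ω` a function `f_ω : [n] → [l]`; then `p > 0` and for every `k`-set `S ⊆ [n]` the number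
`split(S)` of `ω ∈ Ω` splitting `S` with the prescribed part sizes satisfies
`(1 − (δ−1)/2)·p·|Ω| ≤ split(S) ≤ (1 + (δ−1)/2)·p·|Ω|`, hence
`p|Ω|/δ ≤ split(S) ≤ δ·p|Ω|`; so the family `{f_ω}` is a `δ`-balanced `(n,k,l)`-splitter. -/
theorem stmt6 (n k l : ℕ) (hl : 2 ≤ l) (hlk : l ≤ k) (hkn : k ≤ n)
    (δ : ℝ) (hδ1 : 1 < δ) (hδ2 : δ ≤ 2)
    (Ω : Type) [Fintype Ω]
    (X : Fin (n * Nat.clog 2 l) → Ω → Fin 2)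
    -- the `X_i` are `(ε, km)`-independent with `ε = 2^{−km−1}·(δ−1)`,
    -- probabilities being taken with respect to the uniform measure on `Ω`
    (hX : ∀ ι : Fin (k * Nat.clog 2 l) → Fin (n * Nat.clog 2 l), StrictMono ι →
      ∀ α : Fin (k * Nat.clog 2 l) → Fin 2,
        |((Finset.univ.filter fun ω : Ω => ∀ t, X (ι t) ω = α t).card : ℝ) /
            (Fintype.card Ω : ℝ) - 1 / 2 ^ (k * Nat.clog 2 l)| <
          (δ - 1) / 2 ^ (k * Nat.clog 2 l + 1))
    (φ : (Fin (Nat.clog 2 l) → Fin 2) → Fin l) (hφ : Function.Surjective φ) :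
    0 < pBlocks k l (Nat.clog 2 l) φ ∧
    ∀ S : Finset (Fin n), S.card = k →
      ((1 - (δ - 1) / 2) * (pBlocks k l (Nat.clog 2 l) φ * (Fintype.card Ω : ℝ)) ≤
        ((Finset.univ.filter fun ω : Ω => ∀ j : Fin l,
          (S.filter fun x => φ (fun t => X (blockIdx x t) ω) = j).card = target k l j).card : ℝ) ∧
      ((Finset.univ.filter fun ω : Ω => ∀ j : Fin l,
          (S.filter fun x => φ (fun t => X (blockIdx x t) ω) = j).card = target k l j).card : ℝ) ≤
        (1 + (δ - 1) / 2) * (pBlocks k l (Nat.clog 2 l) φ * (Fintype.card Ω : ℝ))) ∧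
      (pBlocks k l (Nat.clog 2 l) φ * (Fintype.card Ω : ℝ) / δ ≤
        ((Finset.univ.filter fun ω : Ω => ∀ j : Fin l,
          (S.filter fun x => φ (fun t => X (blockIdx x t) ω) = j).card = target k l j).card : ℝ) ∧
      ((Finset.univ.filter fun ω : Ω => ∀ j : Fin l,
          (S.filter fun x => φ (fun t => X (blockIdx x t) ω) = j).card = target k l j).card : ℝ) ≤
        δ * (pBlocks k l (Nat.clog 2 l) φ * (Fintype.card Ω : ℝ))) := by
  generalize Nat.clog 2 l = m at *
  refine ⟨pBlocks_pos k l m (by omega) φ hφ, fun S hS => ?_⟩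
  set N : ℝ := (Fintype.card Ω : ℝ) with hN
  set P := pBlocks k l m φ
  have hP0 : 0 < P := pBlocks_pos k l m (by omega) φ hφ
  have hN0 : 0 ≤ N := Nat.cast_nonneg _
  let e := S.orderEmbOfFin hS
  let B : Ω → Fin k → Fin m → Fin 2 := fun ω i t => X (blockIdx (e i) t) ω
  set G := Finset.univ.filter fun b : Fin k → Fin m → Fin 2 =>
    ∀ j : Fin l, (Finset.univ.filter fun i : Fin k => φ (b i) = j).card = target k l j with hG
  have hsplit : (Finset.univ.filter fun ω : Ω => ∀ j : Fin l,
      (S.filter fun x => φ (fun t => X (blockIdx x t) ω) = j).card = target k l j) =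
      Finset.univ.filter fun ω => B ω ∈ G := by
    ext ω
    simp only [hG, Finset.mem_filter, Finset.mem_univ, true_and]
    refine forall_congr' fun j => ?_
    conv_lhs => rw [← Finset.map_orderEmbOfFin_univ S hS, Finset.filter_map, Finset.card_map]
    rfl
  have hpattern : ∀ b ∈ G, |((Finset.univ.filter fun ω => B ω = b).card : ℝ) - N / 2 ^ (k * m)| ≤
      N * ((δ - 1) / 2 ^ (k * m + 1)) := by
    intro b _
    have h := abs_card_filter_blocks_sub_lt X _ _ hX e e.strictMono b
    rcases hN0.eq_or_lt with h0 | hpos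
    · have hcard : (Fintype.card Ω : ℝ) = 0 := by rw [← hN, ← h0]
      have hemp : IsEmpty Ω := Fintype.card_eq_zero_iff.mp (Nat.cast_eq_zero.mp hcard)
      simp [← h0]
    · calc |((Finset.univ.filter fun ω => B ω = b).card : ℝ) - N / 2 ^ (k * m)|
          = N * |((Finset.univ.filter fun ω => B ω = b).card : ℝ) / N - 1 / 2 ^ (k * m)| := by
            rw [← abs_of_pos hpos, ← abs_mul, abs_of_pos hpos]
            congr 1
            field_simp
        _ ≤ N * ((δ - 1) / 2 ^ (k * m + 1)) := by gcongr
  have hmain : |((Finset.univ.filter fun ω => B ω ∈ G).card : ℝ) - G.card * (N / 2 ^ (k * m))| ≤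
      G.card * (N * ((δ - 1) / 2 ^ (k * m + 1))) := by
    convert abs_card_filter_mem_sub_le B G _ _ fun b hb => ?_
    convert hpattern b hb
  have hPG : P = G.card / 2 ^ (k * m) := rfl
  have hmean : (G.card : ℝ) * (N / 2 ^ (k * m)) = P * N := by
    rw [hPG]
    ring
  have hdev : (G.card : ℝ) * (N * ((δ - 1) / 2 ^ (k * m + 1))) = (δ - 1) / 2 * (P * N) := by
    rw [hPG, pow_succ]
    field_simp
  rw [hmean, hdev, abs_le] at hmain
  obtain ⟨hmain₁, hmain₂⟩ := hmain
  rw [hsplit]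
  have hPN : 0 ≤ P * N := by positivity
  have hlower : P * N / δ ≤ (1 - (δ - 1) / 2) * (P * N) := by
    rw [div_le_iff₀ (by linarith)]
    nlinarith [mul_nonneg (mul_nonneg (sub_nonneg.mpr hδ1.le) (sub_nonneg.mpr hδ2)) hPN]
  have hupper : (1 + (δ - 1) / 2) * (P * N) ≤ δ * (P * N) := by
    gcongr
    linarith
  have h1 : (1 - (δ - 1) / 2) * (P * N) ≤ (Finset.univ.filter fun ω => B ω ∈ G).card := by
    linarith
  have h2 : ((Finset.univ.filter fun ω => B ω ∈ G).card : ℝ) ≤ (1 + (δ - 1) / 2) * (P * N) := by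
    linarith
  exact ⟨⟨h1, h2⟩, hlower.trans h1, h2.trans hupper⟩
end

section
/- For all integers 1 ≤ k < l, the quantity p = l!/((l−k)!·l^k) satisfies 1/p ≤ e^{(k² − k/2)/l + 1/12}; equivalently, (l−k)!·l^k / l! ≤ e^{(k² − k/2)/l + 1/12}. -/
/-- The first term of Stirling's sequence exceeds its limit `√π` by a factor at most `e^{1/12}`. -/
theorem stirlingSeq_one_le_exp_mul_sqrt_pi :
    Stirling.stirlingSeq 1 ≤ Real.exp (1 / 12) * √Real.pi := by
  have h : Real.exp (11 / 6) ≤ 2 * Real.pi := by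
    refine le_of_pow_le_pow_left₀ (n := 6) (by norm_num) (by positivity) ?_
    calc Real.exp (11 / 6) ^ 6 = Real.exp 1 ^ 11 := by
          rw [← Real.exp_nat_mul, ← Real.exp_nat_mul]; norm_num
      _ ≤ 2.7182818286 ^ 11 := by gcongr; exact Real.exp_one_lt_d9.le
      _ ≤ (2 * 3.14) ^ 6 := by norm_num
      _ ≤ (2 * Real.pi) ^ 6 := by gcongr; exact Real.pi_gt_d2.le
  rw [Stirling.stirlingSeq_one, div_le_iff₀ (by positivity)]
  calc Real.exp 1 = Real.exp (1 / 12) * √(Real.exp (11 / 6)) := by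
        rw [← Real.exp_half, ← Real.exp_add]; norm_num
    _ ≤ Real.exp (1 / 12) * √(2 * Real.pi) := by gcongr
    _ = Real.exp (1 / 12) * √Real.pi * √2 := by
        rw [Real.sqrt_mul (by norm_num)]; ring

/-- Stirling's formula with the error term isolated in `Stirling.stirlingSeq`. -/
theorem factorial_eq_stirlingSeq_mul {n : ℕ} (hn : n ≠ 0) :
    (n.factorial : ℝ) =
      Stirling.stirlingSeq n * (√(2 * n) * (n / Real.exp 1) ^ n) := by
  have : (0 : ℝ) < n := by positivity
  rw [Stirling.stirlingSeq, div_mul_cancel₀ _ (by positivity)]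

theorem stirlingSeq_le_stirlingSeq_one {n : ℕ} (hn : n ≠ 0) :
    Stirling.stirlingSeq n ≤ Stirling.stirlingSeq 1 := by
  obtain ⟨n, rfl⟩ := Nat.exists_eq_succ_of_ne_zero hn
  exact Stirling.stirlingSeq'_antitone (Nat.zero_le n)

/-- for integers `1 ≤ k < l`, the probability `p = l!/((l−k)!·l^k)` that a
uniformly random function from a `k`-set to `[l]` is injective satisfies
`1/p ≤ e^{(k² − k/2)/l + 1/12}`, i.e. `(l−k)!·l^k / l! ≤ e^{(k² − k/2)/l + 1/12}`. -/
theorem stmt13 (k l : ℕ) (hk : 1 ≤ k) (hkl : k < l) :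
    ((Nat.factorial (l - k) : ℝ) * (l : ℝ) ^ k) / (Nat.factorial l : ℝ) ≤
      Real.exp (((k : ℝ) ^ 2 - (k : ℝ) / 2) / (l : ℝ) + 1 / 12) := by
  obtain ⟨m, rfl⟩ := Nat.exists_eq_add_of_lt hkl
  obtain ⟨n, hn⟩ : ∃ n, n = m + 1 := ⟨_, rfl⟩
  rw [add_assoc, ← hn, Nat.add_sub_cancel_left]
  have hn0 : n ≠ 0 := by omega
  have hl0 : k + n ≠ 0 := by omega
  obtain ⟨L, hL⟩ : ∃ L : ℝ, L = ((k + n : ℕ) : ℝ) := ⟨_, rfl⟩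
  have hLpos : 0 < L := by rw [hL]; positivity
  have hLn : L = k + n := by rw [hL]; push_cast; rfl
  have hle : (n : ℝ) ≤ L * Real.exp (-(k / L)) := by
    calc (n : ℝ) = L * (-(k / L) + 1) := by field_simp; linarith
      _ ≤ L * Real.exp (-(k / L)) := by gcongr; exact Real.add_one_le_exp _
  have hsqrt : √(2 * n) ≤ √(2 * L) * Real.exp (-(k / L) / 2) := by
    rw [Real.exp_half, ← Real.sqrt_mul (by positivity), mul_assoc]
    gcongr
  have hpow : (n / Real.exp 1) ^ n * L ^ k ≤
      Real.exp (k ^ 2 / L) * (L / Real.exp 1) ^ (k + n) := by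
    calc (n / Real.exp 1) ^ n * L ^ k
        ≤ (L * Real.exp (-(k / L)) / Real.exp 1) ^ n * L ^ k := by gcongr
      _ = L ^ (k + n) * Real.exp (n * (-(k / L) - 1)) := by
        rw [mul_div_assoc, ← Real.exp_sub, mul_pow, ← Real.exp_nat_mul]; ring
      _ = L ^ (k + n) * Real.exp (k ^ 2 / L - (k + n : ℕ) * 1) := by
        congr 2
        rw [← hL]
        field_simp
        rw [hLn]; ring
      _ = Real.exp (k ^ 2 / L) * (L / Real.exp 1) ^ (k + n) := by
        rw [Real.exp_sub, Real.exp_nat_mul, div_pow]; ring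
  have hs : Stirling.stirlingSeq n ≤ Real.exp (1 / 12) * Stirling.stirlingSeq (k + n) :=
    calc Stirling.stirlingSeq n ≤ Real.exp (1 / 12) * √Real.pi :=
          (stirlingSeq_le_stirlingSeq_one hn0).trans stirlingSeq_one_le_exp_mul_sqrt_pi
      _ ≤ _ := by gcongr; exact Stirling.sqrt_pi_le_stirlingSeq hl0
  have hspos : 0 ≤ Stirling.stirlingSeq (k + n) :=
    (Real.sqrt_nonneg _).trans (Stirling.sqrt_pi_le_stirlingSeq hl0)
  rw [div_le_iff₀ (by positivity), factorial_eq_stirlingSeq_mul hn0,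
    factorial_eq_stirlingSeq_mul hl0, ← hL]
  calc Stirling.stirlingSeq n * (√(2 * n) * (n / Real.exp 1) ^ n) * L ^ k
      = Stirling.stirlingSeq n * (√(2 * n) * ((n / Real.exp 1) ^ n * L ^ k)) := by ring
    _ ≤ (Real.exp (1 / 12) * Stirling.stirlingSeq (k + n)) *
        ((√(2 * L) * Real.exp (-(k / L) / 2)) *
          (Real.exp (k ^ 2 / L) * (L / Real.exp 1) ^ (k + n))) := by gcongr
    _ = (Real.exp (k ^ 2 / L) * Real.exp (-(k / L) / 2) * Real.exp (1 / 12)) *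
        (Stirling.stirlingSeq (k + n) * (√(2 * L) * (L / Real.exp 1) ^ (k + n))) := by ring
    _ = _ := by
        rw [← Real.exp_add, ← Real.exp_add]
        congr 2
        ring
end

section
/- Let G = (V, E) be a directed graph with |V| = n, let 2 ≤ k ≤ n be an integer, let δ ≥ 1 and T > 0 be reals, and let H be a finite family (multiset) of functions from V to [k] such that for every S ⊆ V with |S| = k, the number of h ∈ H injective on S is between T/δ and δT. For h ∈ H, call a sequence (v_1,…,v_k) of pairwise distinct vertices an h-colorful closed k-sequence if (v_i, v_{i+1}) ∈ E for all 1 ≤ i < k, (v_k, v_1) ∈ E, and the colors h(v_1),…,h(v_k) are pairwise distinct. Let N denote the number of simple directed cycles of size k in G, i.e., the number of equivalence classes, under cyclic rotation, of sequences (v_1,…,v_k) of pairwise distinct vertices with (v_i, v_{i+1}) ∈ E for all 1 ≤ i < k and (v_k, v_1) ∈ E. Then k·T·N/δ ≤ Σ_{h ∈ H} (number of h-colorful closed k-sequences) ≤ δ·k·T·N; consequently, dividing the total count of colorful closed k-sequences over all h ∈ H by k·T approximates N up to a multiplicative factor of δ. -/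
open Finset

attribute [local instance] Classical.propDecidable

/-- The cyclic successor of an index in `Fin k`. -/
def cyclicSucc {k : ℕ} (i : Fin k) : Fin k := ⟨((i : ℕ) + 1) % k, Nat.mod_lt _ i.pos⟩

/-- `(v_1,…,v_k)` is a closed `k`-sequence in the graph `E`: pairwise distinct vertices with
`(v_i, v_{i+1}) ∈ E` for `1 ≤ i < k` and `(v_k, v_1) ∈ E` (the successor index is taken
cyclically in `Fin k`). -/
def IsClosedSeq {V : Type*} (E : V → V → Prop) (k : ℕ) (v : Fin k → V) : Prop :=
  Function.Injective v ∧ ∀ i : Fin k, E (v i) (v (cyclicSucc i))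

/-- The rotations (cyclic shifts) of a sequence `v : Fin k → V`, as a finite set. -/
noncomputable def rotations {V : Type*} (k : ℕ) (v : Fin k → V) : Finset (Fin k → V) :=
  Finset.image (fun r : Fin k => fun i : Fin k => v ⟨((i : ℕ) + (r : ℕ)) % k, Nat.mod_lt _ i.pos⟩) Finset.univ

/-- The number of simple directed cycles of size `k` in the graph `E`: the number of
equivalence classes, under cyclic rotation, of closed `k`-sequences; equivalently, the number
of distinct rotation orbits of closed `k`-sequences. -/
noncomputable def cycleCount {V : Type*} [Fintype V] (E : V → V → Prop) (k : ℕ) : ℕ :=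
  ((Finset.univ.filter fun v : Fin k → V => IsClosedSeq E k v).image (rotations k)).card

/-- The number of `h`-colorful closed `k`-sequences: closed `k`-sequences on which the
coloring `h` assigns pairwise distinct colors. -/
noncomputable def colorfulClosedCount {V : Type*} [Fintype V] (E : V → V → Prop) (k : ℕ)
    (h : V → Fin k) : ℕ :=
  (Finset.univ.filter fun v : Fin k → V =>
    IsClosedSeq E k v ∧ Function.Injective fun i => h (v i)).card

theorem mem_rotations {V : Type*} {k : ℕ} {v w : Fin k → V} :
    w ∈ rotations k v ↔
      ∃ r : Fin k, (fun i : Fin k => v ⟨((i : ℕ) + (r : ℕ)) % k, Nat.mod_lt _ i.pos⟩) = w := by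
  simp [rotations]

theorem self_mem_rotations {V : Type*} {k : ℕ} (hk : 0 < k) (v : Fin k → V) :
    v ∈ rotations k v := by
  refine mem_rotations.2 ⟨⟨0, hk⟩, ?_⟩
  funext i
  congr 1
  ext
  simp [Nat.mod_eq_of_lt i.isLt]

/-- The cyclic shift of `Fin k` by `r` is injective. -/
theorem shift_injective {k : ℕ} (r : ℕ) :
    Function.Injective fun i : Fin k => (⟨((i : ℕ) + r) % k, Nat.mod_lt _ i.pos⟩ : Fin k) := by
  intro i j h
  have h' : (i : ℕ) + r ≡ (j : ℕ) + r [MOD k] := Fin.mk.inj h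
  exact Fin.ext ((h'.add_right_cancel' r).eq_of_lt_of_lt i.isLt j.isLt)

theorem IsClosedSeq.of_mem_rotations {V : Type*} {E : V → V → Prop} {k : ℕ} {v w : Fin k → V}
    (hv : IsClosedSeq E k v) (hw : w ∈ rotations k v) : IsClosedSeq E k w := by
  obtain ⟨r, rfl⟩ := mem_rotations.1 hw
  refine ⟨hv.1.comp (shift_injective (r : ℕ)), fun i => ?_⟩
  convert hv.2 ⟨((i : ℕ) + (r : ℕ)) % k, Nat.mod_lt _ i.pos⟩ using 2
  simp only [cyclicSucc, Fin.mk.injEq, Nat.mod_add_mod]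
  congr 1
  ring

theorem card_rotations {V : Type*} {k : ℕ} {v : Fin k → V} (hv : Function.Injective v) :
    (rotations k v).card = k := by
  rw [rotations, Finset.card_image_of_injective, Finset.card_univ, Fintype.card_fin]
  intro r s h
  have h' : (0 + (r : ℕ)) % k = (0 + (s : ℕ)) % k :=
    Fin.mk.inj (hv (congrFun h ⟨0, r.pos⟩))
  simpa [Nat.mod_eq_of_lt r.isLt, Nat.mod_eq_of_lt s.isLt, Fin.ext_iff] using h'

theorem rotations_subset {V : Type*} {k : ℕ} {v w : Fin k → V} (hw : w ∈ rotations k v) :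
    rotations k w ⊆ rotations k v := by
  obtain ⟨r, rfl⟩ := mem_rotations.1 hw
  intro u hu
  obtain ⟨s, rfl⟩ := mem_rotations.1 hu
  refine mem_rotations.2 ⟨⟨((s : ℕ) + r) % k, Nat.mod_lt _ r.pos⟩, ?_⟩
  funext i
  simp only [Nat.mod_add_mod, Nat.add_mod_mod, add_assoc]

/-- Each simple directed cycle of size `k` corresponds to exactly `k` closed `k`-sequences. -/
theorem card_isClosedSeq {V : Type*} [Fintype V] (E : V → V → Prop) {k : ℕ} (hk : 0 < k) :
    (Finset.univ.filter fun v : Fin k → V => IsClosedSeq E k v).card = cycleCount E k * k := by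
  rw [cycleCount, Finset.card_eq_sum_card_image (rotations k)]
  refine Finset.sum_const_nat fun R hR => ?_
  obtain ⟨v, hv, rfl⟩ := Finset.mem_image.1 hR
  have hv : IsClosedSeq E k v := (Finset.mem_filter.1 hv).2
  refine Eq.trans (congrArg Finset.card (Finset.ext fun w => ?_)) (card_rotations hv.1)
  simp only [Finset.mem_filter, Finset.mem_univ, true_and]
  refine ⟨fun h => h.2 ▸ self_mem_rotations hk w, fun h => ?_⟩
  have hw := hv.of_mem_rotations h
  refine ⟨hw, Finset.eq_of_subset_of_card_le (rotations_subset h) ?_⟩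
  rw [card_rotations hv.1, card_rotations hw.1]

/-- Counting pairs of a coloring and a colorful closed sequence in two ways. -/
theorem sum_colorfulClosedCount {V : Type*} [Fintype V] (E : V → V → Prop) (k : ℕ)
    {ι : Type*} [Fintype ι] (H : ι → V → Fin k) :
    ∑ i, colorfulClosedCount E k (H i) =
      ∑ v : Fin k → V with IsClosedSeq E k v,
        (Finset.univ.filter fun i => Set.InjOn (H i) ↑(Finset.univ.image v)).card := by
  have hcount : ∀ i, colorfulClosedCount E k (H i) =
      (Finset.bipartiteAbove (fun i (v : Fin k → V) => Function.Injective fun j => H i (v j))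
        (Finset.univ.filter fun v : Fin k → V => IsClosedSeq E k v) i).card := fun i => by
    rw [colorfulClosedCount, Finset.bipartiteAbove, Finset.filter_filter]
  simp_rw [hcount]
  rw [Finset.sum_card_bipartiteAbove_eq_sum_card_bipartiteBelow]
  refine Finset.sum_congr rfl fun v hv => ?_
  have hv : IsClosedSeq E k v := (Finset.mem_filter.1 hv).2
  rw [Finset.bipartiteBelow]
  congr 1
  refine Finset.filter_congr fun i _ => ?_
  rw [Finset.coe_image, Finset.coe_univ, Set.image_univ]
  exact ⟨fun h => Function.Injective.injOn_range h,
    fun h a b hab => hv.1 (h (Set.mem_range_self a) (Set.mem_range_self b) hab)⟩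

/-- if `H` is a family of colorings `V → [k]` such that every `k`-set of
vertices is colored injectively by between `T/δ` and `δT` of them, then the total number of
colorful closed `k`-sequences, summed over all colorings of `H`, lies between `k·T·N/δ` and
`δ·k·T·N`, where `N` is the number of simple directed cycles of size `k`; hence dividing the
total count by `k·T` approximates `N` up to a multiplicative factor of `δ`. -/
theorem stmt17 {V : Type*} [Fintype V] (E : V → V → Prop) (k N : ℕ)
    (hk : 2 ≤ k) (hkn : k ≤ Fintype.card V)
    (δ T : ℝ) (hδ : 1 ≤ δ) (hT : 0 < T)
    (H : Fin N → V → Fin k)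
    (hH : ∀ S : Finset V, S.card = k →
      T / δ ≤ ((Finset.univ.filter fun i : Fin N => Set.InjOn (H i) ↑S).card : ℝ) ∧
      ((Finset.univ.filter fun i : Fin N => Set.InjOn (H i) ↑S).card : ℝ) ≤ δ * T) :
    (k : ℝ) * T * (cycleCount E k : ℝ) / δ ≤
        (∑ i : Fin N, (colorfulClosedCount E k (H i) : ℝ)) ∧
    (∑ i : Fin N, (colorfulClosedCount E k (H i) : ℝ)) ≤
        δ * ((k : ℝ) * T * (cycleCount E k : ℝ)) := by
  have hcard := card_isClosedSeq E (k := k) (by omega)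
  have hmem : ∀ v ∈ Finset.univ.filter fun v : Fin k → V => IsClosedSeq E k v,
      (Finset.univ.image v).card = k := fun v hv => by
    rw [Finset.card_image_of_injective _ (Finset.mem_filter.1 hv).2.1, Finset.card_univ,
      Fintype.card_fin]
  rw [← Nat.cast_sum, sum_colorfulClosedCount, Nat.cast_sum]
  constructor
  · refine le_trans (le_of_eq ?_)
      (Finset.card_nsmul_le_sum _ _ _ fun v hv => (hH _ (hmem v hv)).1)
    rw [hcard, nsmul_eq_mul, Nat.cast_mul]
    ring
  · refine (Finset.sum_le_card_nsmul _ _ _ fun v hv => (hH _ (hmem v hv)).2).trans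
      (le_of_eq ?_)
    rw [hcard, nsmul_eq_mul, Nat.cast_mul]
    ring
end
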